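/- Let a, b, k, n be positive integers with n ≥ max{a+b, a+k}, let A ⊆ [n] with |A| = a, and let K be the k-partner of A ∖ A^t. Suppose there exists a b-element set B ⊆ [n] such that the pair (A,B) is maximal, and let b′ = |B ∖ B^t|. Then the pair (A,K) is maximal if and only if k ≥ b′. -/

import Mathlib

open Finset

attribute [local instance] Classical.propDecidable

noncomputable section

/-- The ground set `[n] = {1, …, n}`. -/
def ground (n : ℕ) : Finset ℕ := Finset.Icc 1 n

/-- `C([n], k)`: the family of all `k`-element subsets of `[n]`. -/
def ksubsets (n k : ℕ) : Finset (Finset ℕ) := Finset.powersetCard k (ground n)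

/-- Two families are cross intersecting. -/
def CrossInt (A B : Finset (Finset ℕ)) : Prop :=
  ∀ a ∈ A, ∀ b ∈ B, (a ∩ b).Nonempty

/-- The lexicographic order `A ≺ B`:  `A ⊇ B` or `min (A ∖ B) < min (B ∖ A)`. -/
def lex (A B : Finset ℕ) : Prop :=
  B ⊆ A ∨ (A \ B).min < (B \ A).min

/-- Strict lexicographic order `A ⪵ B`. -/
def lexLT (A B : Finset ℕ) : Prop := lex A B ∧ A ≠ B

/-- `L(R, k)` over `[n]`: all `k`-subsets of `[n]` that are `≺ R`. -/
def Lset (n : ℕ) (R : Finset ℕ) (k : ℕ) : Finset (Finset ℕ) :=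
  (ksubsets n k).filter fun F => lex F R

/-- `L(r, k)`: the first `r` elements of `C([n], k)` in lexicographic order. -/
def Lnum (n r k : ℕ) : Finset (Finset ℕ) :=
  (ksubsets n k).filter fun F => ((ksubsets n k).filter fun G => lex G F).card ≤ r

/-- A family is L-initial if it equals `L(R, k)` for some `k`-set `R` (an ID of the family). -/
def LInitial (n k : ℕ) (A : Finset (Finset ℕ)) : Prop :=
  ∃ R ∈ ksubsets n k, A = Lset n R k

/-- `F` and `H` strongly intersect at their last element; `H` is the partner of `F`
(and `F` is the partner of `H`). -/
def IsPartner (F H : Finset ℕ) : Prop :=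
  ∃ q, F ∩ H = {q} ∧ F ∪ H = Finset.Icc 1 q

/-- `K` is the `k`-partner of `F` (inside `[n]`). -/
def IsKPartner (n k : ℕ) (F K : Finset ℕ) : Prop :=
  ∃ H, IsPartner F H ∧
    ((k = H.card ∧ K = H) ∨
     (H.card < k ∧ K = H ∪ Finset.Icc (n - k + H.card + 1) n) ∨
     (k < H.card ∧ K ∈ ksubsets n k ∧ lex K H ∧
        ∀ K' ∈ ksubsets n k, lex K' H → lex K' K))

/-- `ℓ(F)`: the largest `x` with `{n - x + 1, …, n} ⊆ F` (and `0` if there is none). -/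
def ell (n : ℕ) (F : Finset ℕ) : ℕ :=
  ((Finset.range (n + 1)).filter fun x => Finset.Icc (n - x + 1) n ⊆ F).sup id

/-- `F^t = {n - ℓ(F) + 1, …, n}` (which is `∅` when `ℓ(F) = 0`). -/
def tailPart (n : ℕ) (F : Finset ℕ) : Finset ℕ := Finset.Icc (n - ell n F + 1) n

/-- Maximal cross intersecting families. -/
def MaximalCross (n f g : ℕ) (F G : Finset (Finset ℕ)) : Prop :=
  F ⊆ ksubsets n f ∧ G ⊆ ksubsets n g ∧ CrossInt F G ∧
    ∀ F' G' : Finset (Finset ℕ), F ⊆ F' → F' ⊆ ksubsets n f →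
      G ⊆ G' → G' ⊆ ksubsets n g → CrossInt F' G' → F = F' ∧ G = G'

/-- The pair of sets `(F, G)` is maximal. -/
def PairMaximal (n : ℕ) (F G : Finset ℕ) : Prop :=
  MaximalCross n F.card G.card (Lset n F F.card) (Lset n G G.card)

/-- Maximal pair families. -/
def MaximalPairFamilies (n : ℕ) (A1 A2 : Finset (Finset ℕ)) : Prop :=
  A1.card = A2.card ∧ ∀ a1 ∈ A1, ∃! a2, a2 ∈ A2 ∧ PairMaximal n a1 a2

/-- `H1` is the `|H1|`-parity of `H2` (intended for `|H1| ≤ |H2|`):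
`H1 ∖ H1^t = H2 ∖ H2^t` and `ℓ(H2) - ℓ(H1) = |H2| - |H1|`. -/
def IsParity (n : ℕ) (H1 H2 : Finset ℕ) : Prop :=
  H1 \ tailPart n H1 = H2 \ tailPart n H2 ∧
    ell n H2 + H1.card = ell n H1 + H2.card

/-- The family `H1` of `h1`-sets is the `h1`-parity of the family `H2` of `h2`-sets. -/
def FamParity (n h1 h2 : ℕ) (H1 H2 : Finset (Finset ℕ)) : Prop :=
  (∀ A ∈ H1, ∃ B ∈ ksubsets n h2, IsParity n A B ∧ B ∈ H2) ∧
  (∀ B ∈ H2, ∀ A ∈ ksubsets n h1, IsParity n A B → A ∈ H1)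

/-- An `(n, k 0, …, k (t-1))`-cross intersecting system:  non-empty pairwise
cross intersecting families `F i ⊆ C([n], k i)`. -/
def IsCIS (n : ℕ) {t : ℕ} (k : Fin t → ℕ) (F : Fin t → Finset (Finset ℕ)) : Prop :=
  (∀ i, F i ⊆ ksubsets n (k i)) ∧ (∀ i, (F i).Nonempty) ∧
    ∀ i j : Fin t, i < j → CrossInt (F i) (F j)

/-- An extremal cross intersecting system. -/
def Extremal (n : ℕ) {t : ℕ} (k : Fin t → ℕ) (F : Fin t → Finset (Finset ℕ)) : Prop :=
  IsCIS n k F ∧ ∀ G : Fin t → Finset (Finset ℕ), IsCIS n k G →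
    ∑ i, (G i).card ≤ ∑ i, (F i).card

/-- Two systems of families are isomorphic via a permutation of the ground set `[n]`. -/
def IsoSystems (n : ℕ) {t : ℕ} (F G : Fin t → Finset (Finset ℕ)) : Prop :=
  ∃ σ : Equiv.Perm ℕ, (∀ x ∈ ground n, σ x ∈ ground n) ∧
    ∀ i, F i = (G i).image fun s => s.image ⇑σ

/-- The family `ℛ₂`. -/
def R2fam (n k2 kt : ℕ) : Finset (Finset ℕ) :=
  (ksubsets n k2).filter fun R =>
    lex (insert 1 (Finset.Icc (n - k2 + 2) n)) R ∧
    lex R (insert kt (Finset.Icc (n - k2 + 2) n))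

/-- The family `ℱ₂,₃`. -/
def F23 (n k2 k3 kt : ℕ) : Finset (Finset ℕ) :=
  (R2fam n k2 kt).filter fun A => ∃ B ∈ ksubsets n k3, PairMaximal n A B

theorem lex_iff (A B : Finset ℕ) :
    lex A B ↔ B ⊆ A ∨ ∃ m ∈ A, m ∉ B ∧ ∀ x ∈ B, x ∉ A → m < x := by
  refine or_congr Iff.rfl ⟨fun h => ?_, ?_⟩
  · have hne : (A \ B).Nonempty := by
      rw [nonempty_iff_ne_empty]
      intro he
      simp [he] at h
    obtain ⟨m, hm⟩ := min_of_nonempty hne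
    have hmem := mem_sdiff.1 (mem_of_min hm)
    refine ⟨m, hmem.1, hmem.2, fun x hxB hxA => ?_⟩
    rw [hm] at h
    exact WithTop.coe_lt_coe.1 (h.trans_le (min_le (mem_sdiff.2 ⟨hxB, hxA⟩)))
  · rintro ⟨m, hmA, hmB, hlt⟩
    refine (min_le (mem_sdiff.2 ⟨hmA, hmB⟩)).trans_lt ?_
    by_cases hne : (B \ A).Nonempty
    · obtain ⟨x, hx⟩ := min_of_nonempty hne
      have hmem := mem_sdiff.1 (mem_of_min hx)
      rw [hx]
      exact WithTop.coe_lt_coe.2 (hlt x hmem.1 hmem.2)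
    · rw [not_nonempty_iff_eq_empty.1 hne, min_empty]
      exact WithTop.coe_lt_top m

theorem exists_of_not_lex {A B : Finset ℕ} (h : ¬ lex A B) :
    ∃ m ∈ B, m ∉ A ∧ ∀ x ∈ A, x ∉ B → m < x := by
  rw [lex_iff, not_or] at h
  obtain ⟨hsub, hmin⟩ := h
  have hne : (B \ A).Nonempty := sdiff_nonempty.2 hsub
  have hmem := mem_sdiff.1 (min'_mem _ hne)
  refine ⟨(B \ A).min' hne, hmem.1, hmem.2, fun x hxA hxB => ?_⟩
  by_contra hle
  refine hmin ⟨x, hxA, hxB, fun y hyB hyA => ?_⟩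
  have hy : (B \ A).min' hne ≤ y := min'_le _ _ (mem_sdiff.2 ⟨hyB, hyA⟩)
  have hxy : x ≠ y := fun he => hyA (he ▸ hxA)
  omega

theorem lex_refl (A : Finset ℕ) : lex A A := Or.inl Subset.rfl

theorem lex_antisymm {A B : Finset ℕ} (hAB : lex A B) (hBA : lex B A) : A = B := by
  rw [lex_iff] at hAB hBA
  rcases hAB with h | ⟨m, hmA, hmB, hm⟩
  · rcases hBA with h' | ⟨m', hmB', hmA', -⟩
    · exact Subset.antisymm h' h
    · exact absurd (h hmB') hmA'
  · rcases hBA with h' | ⟨m', hmB', hmA', hm'⟩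
    · exact absurd (h' hmA) hmB
    · have h1 := hm m' hmB' hmA'
      have h2 := hm' m hmA hmB
      omega

theorem mem_ksubsets {n k : ℕ} {X : Finset ℕ} :
    X ∈ ksubsets n k ↔ X ⊆ ground n ∧ X.card = k := mem_powersetCard

theorem mem_Lset {n k : ℕ} {R X : Finset ℕ} :
    X ∈ Lset n R k ↔ X ∈ ksubsets n k ∧ lex X R := mem_filter

theorem MaximalCross.mem_right {n f g : ℕ} {P Q : Finset (Finset ℕ)}
    (h : MaximalCross n f g P Q) {Y : Finset ℕ} (hY : Y ∈ ksubsets n g)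
    (hcross : ∀ X ∈ P, (X ∩ Y).Nonempty) : Y ∈ Q := by
  obtain ⟨hP, hQ, hPQ, hmax⟩ := h
  have := (hmax P (insert Y Q) Subset.rfl hP (subset_insert _ _)
    (insert_subset hY hQ) fun X hX Z hZ => ?_).2
  · rw [this]
    exact mem_insert_self _ _
  · rcases mem_insert.1 hZ with rfl | hZ
    · exact hcross X hX
    · exact hPQ X hX Z hZ

theorem MaximalCross.mem_left {n f g : ℕ} {P Q : Finset (Finset ℕ)}
    (h : MaximalCross n f g P Q) {X : Finset ℕ} (hX : X ∈ ksubsets n f)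
    (hcross : ∀ Y ∈ Q, (X ∩ Y).Nonempty) : X ∈ P := by
  obtain ⟨hP, hQ, hPQ, hmax⟩ := h
  have := (hmax (insert X P) Q (subset_insert _ _) (insert_subset hX hP)
    Subset.rfl hQ fun Z hZ Y hY => ?_).1
  · rw [this]
    exact mem_insert_self _ _
  · rcases mem_insert.1 hZ with rfl | hZ
    · exact hcross Y hY
    · exact hPQ Z hZ Y hY

theorem maximalCross_of_closed {n f g : ℕ} {P Q : Finset (Finset ℕ)}
    (hP : P ⊆ ksubsets n f) (hQ : Q ⊆ ksubsets n g) (hPQ : CrossInt P Q)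
    (hl : ∀ X ∈ ksubsets n f, (∀ Y ∈ Q, (X ∩ Y).Nonempty) → X ∈ P)
    (hr : ∀ Y ∈ ksubsets n g, (∀ X ∈ P, (X ∩ Y).Nonempty) → Y ∈ Q) :
    MaximalCross n f g P Q :=
  ⟨hP, hQ, hPQ, fun _ _ hPP hP' hQQ hQ' hc =>
    ⟨Subset.antisymm hPP fun X hX => hl X (hP' hX) fun Y hY => hc X hX Y (hQQ hY),
      Subset.antisymm hQQ fun Y hY => hr Y (hQ' hY) fun X hX => hc X (hPP hX) Y hY⟩⟩

theorem IsPartner.symm {F H : Finset ℕ} (h : IsPartner F H) : IsPartner H F := by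
  obtain ⟨q, h1, h2⟩ := h
  exact ⟨q, by rw [inter_comm, h1], by rw [union_comm, h2]⟩

theorem exists_small_of_lex {X F : Finset ℕ} {q : ℕ} (hF : ∀ x ∈ F, x ≤ q)
    (h : lex X F) :
    F ⊆ X ∨ ∃ m ∈ X, m ∉ F ∧ m ≤ q ∧ ∀ x ∈ F, x ∉ X → m < x := by
  rcases (lex_iff _ _).1 h with h | ⟨m, hm, hmF, hlt⟩
  · exact Or.inl h
  · by_cases hmq : m ≤ q
    · exact Or.inr ⟨m, hm, hmF, hmq, hlt⟩
    · refine Or.inl fun x hx => ?_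
      by_contra hxX
      have h1 := hlt x hx hxX
      have h2 := hF x hx
      omega

theorem IsPartner.inter_nonempty {n : ℕ} {F H X Y : Finset ℕ} (h : IsPartner F H)
    (hXg : X ⊆ ground n) (hYg : Y ⊆ ground n)
    (hX : lex X F) (hY : lex Y H) : (X ∩ Y).Nonempty := by
  obtain ⟨q, hi, hu⟩ := h
  have hq : q ∈ F ∩ H := by rw [hi]; exact mem_singleton_self q
  obtain ⟨hqF, hqH⟩ := mem_inter.1 hq
  have hmem : ∀ x, x ∈ F ∨ x ∈ H ↔ 1 ≤ x ∧ x ≤ q := fun x => by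
    rw [← mem_union, hu, mem_Icc]
  have key : ∀ x, x ∈ X → x ∉ F → x ≤ q → x ∈ H := fun x hx hxF hxq =>
    ((hmem x).2 ⟨(mem_Icc.1 (hXg hx)).1, hxq⟩).resolve_left hxF
  have key' : ∀ x, x ∈ Y → x ∉ H → x ≤ q → x ∈ F := fun x hx hxH hxq =>
    ((hmem x).2 ⟨(mem_Icc.1 (hYg hx)).1, hxq⟩).resolve_right hxH
  rcases exists_small_of_lex (fun x hx => ((hmem x).1 (Or.inl hx)).2) hX with
    hX | ⟨m, hmX, hmF, hmq, hm⟩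
  · rcases exists_small_of_lex (fun x hx => ((hmem x).1 (Or.inr hx)).2) hY with
      hY | ⟨m', hmY', hmH', hmq', hm'⟩
    · exact ⟨q, mem_inter.2 ⟨hX hqF, hY hqH⟩⟩
    · exact ⟨m', mem_inter.2 ⟨hX (key' m' hmY' hmH' hmq'), hmY'⟩⟩
  · rcases exists_small_of_lex (fun x hx => ((hmem x).1 (Or.inr hx)).2) hY with
      hY | ⟨m', hmY', hmH', hmq', hm'⟩
    · exact ⟨m, mem_inter.2 ⟨hmX, hY (key m hmX hmF hmq)⟩⟩
    · by_contra hno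
      have hdisj : ∀ x, x ∈ X → x ∉ Y := fun x hx hy => hno ⟨x, mem_inter.2 ⟨hx, hy⟩⟩
      have h1 := hm m' (key' m' hmY' hmH' hmq') fun h => hdisj _ h hmY'
      have h2 := hm' m (key m hmX hmF hmq) (hdisj m hmX)
      omega

/-- A set meeting every `a`-set preceding `F` precedes the partner of `F`. -/
theorem IsPartner.lex_of_inter_nonempty {n a b : ℕ} {F H Y : Finset ℕ}
    (h : IsPartner F H) (hFg : F ⊆ ground n) (hFa : F.card ≤ a) (hab : a + b ≤ n)
    (hY : Y ∈ ksubsets n b)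
    (hcross : ∀ X ∈ Lset n F a, (X ∩ Y).Nonempty) : lex Y H := by
  obtain ⟨q, hi, hu⟩ := h
  have hq : q ∈ F ∩ H := by rw [hi]; exact mem_singleton_self q
  obtain ⟨hqF, hqH⟩ := mem_inter.1 hq
  have hmem : ∀ x, x ∈ F ∨ x ∈ H ↔ 1 ≤ x ∧ x ≤ q := fun x => by
    rw [← mem_union, hu, mem_Icc]
  have hFH : ∀ x, x ∈ F → x ∈ H → x = q := fun x hx hx' =>
    mem_singleton.1 (hi ▸ mem_inter.2 ⟨hx, hx'⟩)
  obtain ⟨hYg, hYb⟩ := mem_ksubsets.1 hY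
  by_contra hlex
  obtain ⟨m, hmH, hmY, hm⟩ := exists_of_not_lex hlex
  have hmq := (hmem m).1 (Or.inr hmH)
  have hqn := mem_Icc.1 (hFg hqF)
  set S := insert m (F.filter (· ≤ m)) with hS
  have hSY : S ⊆ ground n \ Y := by
    intro x hx
    rw [mem_sdiff]
    rcases mem_insert.1 hx with rfl | hx
    · exact ⟨mem_Icc.2 ⟨hmq.1, hmq.2.trans hqn.2⟩, hmY⟩
    · obtain ⟨hxF, hxm⟩ := mem_filter.1 hx
      refine ⟨hFg hxF, fun hxY => ?_⟩
      by_cases hxH : x ∈ H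
      · have := hFH x hxF hxH
        have : x = m := by omega
        exact hmY (this ▸ hxY)
      · have := hm x hxY hxH
        omega
  have hScard : S.card ≤ a := by
    by_cases hmF : m ∈ F
    · exact (card_le_card (insert_subset hmF (filter_subset _ _))).trans hFa
    · have hss : F.filter (· ≤ m) ⊂ F := by
        refine filter_ssubset.2 ⟨q, hqF, fun hle => hmF ?_⟩
        have : m = q := by omega
        exact this ▸ hqF
      have := card_lt_card hss
      have := card_insert_le m (F.filter (· ≤ m))
      rw [hS]
      omega
  have hbig : a ≤ (ground n \ Y).card := by
    rw [card_sdiff_of_subset hYg, hYb, ground, Nat.card_Icc]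
    omega
  obtain ⟨X, hSX, hXY, hXa⟩ := exists_subsuperset_card_eq hSY hScard hbig
  have hXF : lex X F := by
    rw [lex_iff]
    by_cases hmF : m ∈ F
    · left
      have := hFH m hmF hmH
      intro x hx
      refine hSX (mem_insert_of_mem (mem_filter.2 ⟨hx, ?_⟩))
      rw [this]
      exact ((hmem x).1 (Or.inl hx)).2
    · refine Or.inr ⟨m, hSX (mem_insert_self _ _), hmF, fun x hx hxX => ?_⟩
      by_contra hle
      exact hxX (hSX (mem_insert_of_mem (mem_filter.2 ⟨hx, not_lt.1 hle⟩)))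
  obtain ⟨x, hx⟩ := hcross X
    (mem_Lset.2 ⟨mem_ksubsets.2 ⟨hXY.trans sdiff_subset, hXa⟩, hXF⟩)
  obtain ⟨hx1, hx2⟩ := mem_inter.1 hx
  exact (mem_sdiff.1 (hXY hx1)).2 hx2

theorem maximalCross_of_isPartner {n a b : ℕ} {F H : Finset ℕ} (h : IsPartner F H)
    (hFg : F ⊆ ground n) (hHg : H ⊆ ground n) (hFa : F.card ≤ a) (hHb : H.card ≤ b)
    (hab : a + b ≤ n) : MaximalCross n a b (Lset n F a) (Lset n H b) := by
  refine maximalCross_of_closed (filter_subset _ _) (filter_subset _ _) ?_ ?_ ?_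
  · intro X hX Y hY
    obtain ⟨hX, hXF⟩ := mem_Lset.1 hX
    obtain ⟨hY, hYH⟩ := mem_Lset.1 hY
    exact h.inter_nonempty (mem_ksubsets.1 hX).1 (mem_ksubsets.1 hY).1 hXF hYH
  · refine fun X hX hc => mem_Lset.2 ⟨hX, ?_⟩
    refine h.symm.lex_of_inter_nonempty hHg hHb (by omega) hX fun Y hY => ?_
    rw [inter_comm]
    exact hc Y hY
  · exact fun Y hY hc => mem_Lset.2 ⟨hY, h.lex_of_inter_nonempty hFg hFa hab hY hc⟩

theorem Lset_union_Icc {n k q j : ℕ} {F : Finset ℕ} (hF : ∀ x ∈ F, x ≤ q)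
    (hq : q + j ≤ n) (hcard : F.card + j = k) :
    Lset n (F ∪ Icc (n - j + 1) n) k = Lset n F k := by
  have hdisj : Disjoint F (Icc (n - j + 1) n) := by
    rw [disjoint_left]
    intro x hx hx'
    have := hF x hx
    have := (mem_Icc.1 hx').1
    omega
  ext X
  rw [mem_Lset, mem_Lset]
  refine and_congr_right fun hX => ?_
  obtain ⟨hXg, hXk⟩ := mem_ksubsets.1 hX
  have hRcard : (F ∪ Icc (n - j + 1) n).card = X.card := by
    rw [card_union_of_disjoint hdisj, Nat.card_Icc, hXk]
    omega
  rw [lex_iff, lex_iff]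
  constructor
  · rintro (h | ⟨m, hmX, hmR, hm⟩)
    · exact Or.inl (subset_union_left.trans h)
    · exact Or.inr ⟨m, hmX, fun hmF => hmR (mem_union_left _ hmF),
        fun x hx hxX => hm x (mem_union_left _ hx) hxX⟩
  · intro h
    by_cases hsub : F ⊆ X
    · by_cases hRX : F ∪ Icc (n - j + 1) n ⊆ X
      · exact Or.inl hRX
      · right
        have hXR : ¬ X ⊆ F ∪ Icc (n - j + 1) n := fun hs =>
          hRX (eq_of_subset_of_card_le hs hRcard.le).ge
        obtain ⟨m, hmX, hmR⟩ := not_subset.1 hXR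
        refine ⟨m, hmX, hmR, fun x hx hxX => ?_⟩
        have hxI := mem_Icc.1 ((mem_union.1 hx).resolve_left fun hxF => hxX (hsub hxF))
        have hmn := mem_Icc.1 (hXg hmX)
        by_contra hle
        exact hmR (mem_union_right _ (mem_Icc.2 (by omega)))
    · obtain ⟨m, hmX, hmF, hm⟩ := h.resolve_left hsub
      obtain ⟨y, hyF, hyX⟩ := not_subset.1 hsub
      have h1 := hm y hyF hyX
      have h2 := hF y hyF
      refine Or.inr ⟨m, hmX, fun hmR => ?_, fun x hx hxX => ?_⟩
      · have := mem_Icc.1 ((mem_union.1 hmR).resolve_left hmF)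
        omega
      · rcases mem_union.1 hx with hx | hx
        · exact hm x hx hxX
        · have := mem_Icc.1 hx
          omega

theorem ell_spec (n : ℕ) (F : Finset ℕ) : ell n F ≤ n ∧ tailPart n F ⊆ F := by
  have hne : ((range (n + 1)).filter fun x => Icc (n - x + 1) n ⊆ F).Nonempty :=
    ⟨0, by simp⟩
  obtain ⟨x, hx, hxs⟩ := exists_mem_eq_sup _ hne id
  have hx' : ell n F = x := hxs
  obtain ⟨h1, h2⟩ := mem_filter.1 hx
  rw [tailPart, hx']
  exact ⟨Nat.lt_succ_iff.1 (mem_range.1 h1), h2⟩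

theorem le_ell {n x : ℕ} {F : Finset ℕ} (hx : x ≤ n) (h : Icc (n - x + 1) n ⊆ F) :
    x ≤ ell n F :=
  le_sup (f := id) (mem_filter.2 ⟨mem_range.2 (Nat.lt_succ_of_le hx), h⟩)

theorem sub_ell_notMem {n : ℕ} {F : Finset ℕ} (hF : F ⊆ ground n) : n - ell n F ∉ F := by
  intro hmem
  have h1 := mem_Icc.1 (hF hmem)
  have h2 := ell_spec n F
  have : ell n F + 1 ≤ ell n F := le_ell (by omega) fun x hx => by
    have hx := mem_Icc.1 hx
    by_cases he : x = n - ell n F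
    · exact he ▸ hmem
    · exact h2.2 (mem_Icc.2 (by omega))
  omega

theorem ell_eq {n j : ℕ} {F : Finset ℕ} (hj : j ≤ n) (hsub : Icc (n - j + 1) n ⊆ F)
    (hnot : n - j ∉ F) : ell n F = j := by
  refine le_antisymm ?_ (le_ell hj hsub)
  by_contra hlt
  have h := ell_spec n F
  exact hnot (h.2 (mem_Icc.2 (by omega)))

theorem union_Icc_sdiff_tailPart {n q j : ℕ} {F : Finset ℕ} (hF : ∀ x ∈ F, x ≤ q)
    (hq : q + j < n) :
    (F ∪ Icc (n - j + 1) n) \ tailPart n (F ∪ Icc (n - j + 1) n) = F := by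
  have hell : ell n (F ∪ Icc (n - j + 1) n) = j := by
    refine ell_eq (by omega) subset_union_right fun hmem => ?_
    rcases mem_union.1 hmem with h | h
    · have := hF _ h
      omega
    · have := mem_Icc.1 h
      omega
  rw [tailPart, hell, union_sdiff_right, Finset.sdiff_eq_self_iff_disjoint, disjoint_left]
  intro x hx hx'
  have := hF x hx
  have := mem_Icc.1 hx'
  omega

theorem IsPartner.card_add_card {F H : Finset ℕ} {q : ℕ} (hi : F ∩ H = {q})
    (hu : F ∪ H = Icc 1 q) : F.card + H.card = q + 1 := by
  have h := card_union_add_card_inter F H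
  rw [hi, hu, Nat.card_Icc, card_singleton] at h
  omega

/-- If `b < |H|`, some `a`-set after `F` still meets every `b`-set preceding the partner `H`. -/
theorem exists_not_lex_inter_nonempty {n a b q : ℕ} {F H : Finset ℕ}
    (hi : F ∩ H = {q}) (hu : F ∪ H = Icc 1 q) (hFa : F.card ≤ a)
    (hqa : q + 1 + a ≤ n + F.card) (hb : b < H.card) :
    ∃ X ∈ ksubsets n a, ¬ lex X F ∧ ∀ Y ∈ Lset n H b, (X ∩ Y).Nonempty := by
  have hq : q ∈ F ∩ H := by rw [hi]; exact mem_singleton_self q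
  obtain ⟨hqF, hqH⟩ := mem_inter.1 hq
  have hmem : ∀ x, x ∈ F ∨ x ∈ H ↔ 1 ≤ x ∧ x ≤ q := fun x => by
    rw [← mem_union, hu, mem_Icc]
  have hqpos := ((hmem q).1 (Or.inl hqF)).1
  have hFpos : 0 < F.card := card_pos.2 ⟨q, hqF⟩
  set X := F.erase q ∪ Icc (q + 1) (q + 1 + (a - F.card)) with hX
  have hqX : q ∉ X := by simp [hX]
  refine ⟨X, mem_ksubsets.2 ⟨fun x hx => ?_, ?_⟩, fun hlex => ?_, fun Y hY => ?_⟩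
  · rcases mem_union.1 hx with hx | hx
    · have := (hmem x).1 (Or.inl (mem_of_mem_erase hx))
      exact mem_Icc.2 (by omega)
    · have := mem_Icc.1 hx
      exact mem_Icc.2 (by omega)
  · rw [hX, card_union_of_disjoint, card_erase_of_mem hqF, Nat.card_Icc]
    · omega
    · rw [disjoint_left]
      intro x hx hx'
      have := (hmem x).1 (Or.inl (mem_of_mem_erase hx))
      have := mem_Icc.1 hx'
      omega
  · rcases (lex_iff _ _).1 hlex with h | ⟨m, hmX, hmF, hm⟩
    · exact hqX (h hqF)
    · have h1 := hm q hqF hqX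
      rcases mem_union.1 hmX with h | h
      · exact hmF (mem_of_mem_erase h)
      · have := mem_Icc.1 h
        omega
  · obtain ⟨hYk, hYH⟩ := mem_Lset.1 hY
    obtain ⟨hYg, hYb⟩ := mem_ksubsets.1 hYk
    have hHY : ¬ H ⊆ Y := fun h => by
      have := card_le_card h
      omega
    obtain ⟨m, hmY, hmH, hmq, hm⟩ := (exists_small_of_lex
      (fun x hx => ((hmem x).1 (Or.inr hx)).2) hYH).resolve_left hHY
    have hmF := ((hmem m).2 ⟨(mem_Icc.1 (hYg hmY)).1, hmq⟩).resolve_right hmH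
    exact ⟨m, mem_inter.2 ⟨mem_union_left _
      (mem_erase.2 ⟨fun h => hmH (h ▸ hqH), hmF⟩), hmY⟩⟩

/-- with `K` the `k`-partner of `A ∖ A^t` and `(A,B)` maximal,
`(A,K)` is maximal iff `k ≥ |B ∖ B^t|`. -/
theorem pairMaximal_kpartner_iff (a b k n : ℕ) (ha : 0 < a) (hb : 0 < b) (hk : 0 < k)
    (hn1 : a + b ≤ n) (hn2 : a + k ≤ n)
    (A K B : Finset ℕ) (hA : A ⊆ ground n) (hAcard : A.card = a)
    (hK : IsKPartner n k (A \ tailPart n A) K)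
    (hB : B ∈ ksubsets n b) (hAB : PairMaximal n A B) :
    (PairMaximal n A K ↔ (B \ tailPart n B).card ≤ k) := by
  obtain ⟨H, ⟨q, hi, hu⟩, hcases⟩ := hK
  set F := A \ tailPart n A with hFdef
  have hpart : IsPartner F H := ⟨q, hi, hu⟩
  have hcard := IsPartner.card_add_card hi hu
  have hqF : q ∈ F := (mem_inter.1 (hi ▸ mem_singleton_self q)).1
  have hmem : ∀ x, x ∈ F ∨ x ∈ H ↔ 1 ≤ x ∧ x ≤ q := fun x => by
    rw [← mem_union, hu, mem_Icc]
  have hFq : ∀ x ∈ F, x ≤ q := fun x hx => ((hmem x).1 (Or.inl hx)).2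
  have hHq : ∀ x ∈ H, x ≤ q := fun x hx => ((hmem x).1 (Or.inr hx)).2
  obtain ⟨hln, htail⟩ := ell_spec n A
  have hFcard : F.card + ell n A = a := by
    have h := card_sdiff_add_card_eq_card htail
    rw [← hFdef, hAcard, tailPart, Nat.card_Icc] at h
    omega
  obtain ⟨hqA, hqt⟩ := mem_sdiff.1 hqF
  have hqn := mem_Icc.1 (hA hqA)
  have hql : q + ell n A < n := by
    have h1 : q ≠ n - ell n A := fun h => sub_ell_notMem hA (h ▸ hqA)
    have h2 : ¬ (n - ell n A + 1 ≤ q ∧ q ≤ n) := fun h => hqt (mem_Icc.2 h)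
    omega
  have hFg : F ⊆ ground n := sdiff_subset.trans hA
  have hHg : H ⊆ ground n := fun x hx => by
    have := (hmem x).1 (Or.inr hx)
    exact mem_Icc.2 (by omega)
  have hAeq : F ∪ Icc (n - ell n A + 1) n = A := sdiff_union_of_subset htail
  have hLA : Lset n A a = Lset n F a := by
    conv_lhs => rw [← hAeq]
    exact Lset_union_Icc hFq hql.le hFcard
  have hLH : ∀ c, H.card ≤ c → a + c ≤ n →
      Lset n (H ∪ Icc (n - (c - H.card) + 1) n) c = Lset n H c := fun c h1 h2 =>
    Lset_union_Icc hHq (by omega) (by omega)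
  have hmax : ∀ c Y, Y.card = c → a + c ≤ n → PairMaximal n A Y →
      Lset n Y c = Lset n H c ∧ H.card ≤ c := by
    intro c Y hYc hac hAY
    rw [PairMaximal, hAcard, hYc, hLA] at hAY
    have hL : Lset n Y c = Lset n H c := by
      refine Subset.antisymm (fun Z hZ => ?_) fun Z hZ => ?_
      · have hZ' := (mem_Lset.1 hZ).1
        exact mem_Lset.2 ⟨hZ', hpart.lex_of_inter_nonempty hFg (by omega) hac hZ'
          fun X hX => hAY.2.2.1 X hX Z hZ⟩
      · obtain ⟨hZ', hZH⟩ := mem_Lset.1 hZ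
        refine hAY.mem_right hZ' fun X hX => ?_
        obtain ⟨hX', hXF⟩ := mem_Lset.1 hX
        exact hpart.inter_nonempty (mem_ksubsets.1 hX').1 (mem_ksubsets.1 hZ').1 hXF hZH
    refine ⟨hL, ?_⟩
    by_contra hlt
    obtain ⟨X, hX, hXF, hXY⟩ := exists_not_lex_inter_nonempty (n := n) (a := a) hi hu
      (by omega) (by omega) (not_le.1 hlt)
    rw [hL] at hAY
    exact hXF (mem_Lset.1 (hAY.mem_left hX hXY)).2
  obtain ⟨hBg, hBb⟩ := mem_ksubsets.1 hB
  obtain ⟨hLB, hHb⟩ := hmax b B hBb hn1 hAB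
  have hBH : B \ tailPart n B = H := by
    rw [← hLH b hHb hn1] at hLB
    set R := H ∪ Icc (n - (b - H.card) + 1) n with hR
    have hRk : R ∈ ksubsets n b := by
      refine mem_ksubsets.2 ⟨union_subset hHg fun x hx => ?_, ?_⟩
      · have := mem_Icc.1 hx
        exact mem_Icc.2 (by omega)
      · rw [hR, card_union_of_disjoint, Nat.card_Icc]
        · omega
        · rw [disjoint_left]
          intro x hx hx'
          have := hHq x hx
          have := mem_Icc.1 hx'
          omega
    have h1 : lex B R := (mem_Lset.1 (hLB ▸ mem_Lset.2 ⟨hB, lex_refl B⟩)).2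
    have h2 : lex R B := (mem_Lset.1 (hLB.symm ▸ mem_Lset.2 ⟨hRk, lex_refl R⟩)).2
    rw [lex_antisymm h1 h2]
    exact union_Icc_sdiff_tailPart hHq (by omega)
  rw [hBH]
  have hKc : K.card = k := by
    rcases hcases with ⟨h1, h2⟩ | ⟨h1, h2⟩ | ⟨-, h2, -⟩
    · rw [h2, h1]
    · rw [h2, card_union_of_disjoint, Nat.card_Icc]
      · omega
      · rw [disjoint_left]
        intro x hx hx'
        have := hHq x hx
        have := mem_Icc.1 hx'
        omega
    · exact (mem_ksubsets.1 h2).2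
  refine ⟨fun h => (hmax k K hKc hn2 h).2, fun hHk => ?_⟩
  have hLK : Lset n K k = Lset n H k := by
    rcases hcases with ⟨-, h2⟩ | ⟨h1, h2⟩ | ⟨h1, -⟩
    · rw [h2]
    · have hsub : n - (k - H.card) + 1 = n - k + H.card + 1 := by omega
      rw [h2, ← hLH k hHk hn2, hsub]
    · omega
  rw [PairMaximal, hAcard, hKc, hLA, hLK]
  exact maximalCross_of_isPartner hpart hFg hHg (by omega) hHk hn2
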